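/- Let m, q∞ > 0, ϑ₀ ∈ (0, π/2) and ϑ(t) = (1/2)·arccot(cot(2ϑ₀) + m t/(4q∞²)). Then the entries of the matrices exp(±B(ϑ(t))) satisfy, uniformly as t → ∞: the (1,1) and (2,2) entries are O(1), the (1,2) entry is O(t+1), and the (2,1) entry is O((t+1)^{−3}). -/

import Mathlib

open MeasureTheory Metric Real Filter Topology Set

noncomputable section

/-- `arccot`, with values in `(0, π)`. -/
def arccotR (x : ℝ) : ℝ := π / 2 - Real.arctan x

/-- The explicit angle `ϑ(t) = (1/2)·arccot(cot(2ϑ₀) + m t/(4q∞²))`. -/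
def thetaF (m qinf ϑ₀ t : ℝ) : ℝ :=
  (1 / 2) * arccotR (Real.cot (2 * ϑ₀) + m * t / (4 * qinf ^ 2))

/-- `p*(t) = q∞ / sin ϑ(t)`. -/
def pstarF (m qinf ϑ₀ t : ℝ) : ℝ := qinf / Real.sin (thetaF m qinf ϑ₀ t)

/-- `q*(t) = q∞ / cos ϑ(t)`. -/
def qstarF (m qinf ϑ₀ t : ℝ) : ℝ := qinf / Real.cos (thetaF m qinf ϑ₀ t)

/-- `r(t) = 2q∞ / sin(2ϑ(t))`, so that `p* + i q* = r e^{iϑ}`. -/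
def rstarF (m qinf ϑ₀ t : ℝ) : ℝ := 2 * qinf / Real.sin (2 * thetaF m qinf ϑ₀ t)

/-- The point-vortex nonlinearity `F(x,y) = (m/2)(1/x − x/(x²+y²))`. -/
def Fpv (m x y : ℝ) : ℝ := (m / 2) * (1 / x - x / (x ^ 2 + y ^ 2))

/-- The linearization matrix `A(p,q)` of the point-vortex system. -/
def Apv (m p q : ℝ) : Matrix (Fin 2) (Fin 2) ℝ :=
  (m / 2) • !![-2 * p * q / (p ^ 2 + q ^ 2) ^ 2,
               1 / q ^ 2 + (p ^ 2 - q ^ 2) / (p ^ 2 + q ^ 2) ^ 2;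
               -1 / p ^ 2 + (p ^ 2 - q ^ 2) / (p ^ 2 + q ^ 2) ^ 2,
               2 * p * q / (p ^ 2 + q ^ 2) ^ 2]

/-- The matrix `B(ϑ)`. -/
def Bmat (ϑ : ℝ) : Matrix (Fin 2) (Fin 2) ℝ :=
  !![-(1 / 2) * Real.cos (2 * ϑ),
     Real.cos ϑ / Real.sin ϑ - (1 / 2) * Real.sin (2 * ϑ);
     Real.sin ϑ / Real.cos ϑ - (1 / 2) * Real.sin (2 * ϑ),
     (1 / 2) * Real.cos (2 * ϑ)]

/-- The matrix `M(ϑ)`. -/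
def Mmat (ϑ : ℝ) : Matrix (Fin 2) (Fin 2) ℝ :=
  !![Real.sin (2 * ϑ), -1 / Real.sin ϑ ^ 2 - Real.cos (2 * ϑ);
     1 / Real.cos ϑ ^ 2 - Real.cos (2 * ϑ), -Real.sin (2 * ϑ)]

/-- The matrix exponential, as the sum of the exponential power series. -/
def matExp (A : Matrix (Fin 2) (Fin 2) ℝ) : Matrix (Fin 2) (Fin 2) ℝ :=
  ∑' n : ℕ, ((n.factorial : ℝ)⁻¹) • A ^ n

/-- The exponential of a matrix whose square is the scalar `r ^ 2`. -/
theorem matExp_of_sq (A : Matrix (Fin 2) (Fin 2) ℝ) {r : ℝ} (hr : r ≠ 0)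
    (hA : A ^ 2 = r ^ 2 • (1 : Matrix (Fin 2) (Fin 2) ℝ)) :
    matExp A = Real.cosh r • (1 : Matrix (Fin 2) (Fin 2) ℝ) + (Real.sinh r / r) • A := by
  have hev : ∀ k : ℕ, A ^ (2 * k) = r ^ (2 * k) • (1 : Matrix (Fin 2) (Fin 2) ℝ) := by
    intro k
    rw [pow_mul, hA, smul_pow, one_pow, ← pow_mul]
  have h1 : HasSum (fun k : ℕ => (((2 * k).factorial : ℝ)⁻¹) • A ^ (2 * k))
      (Real.cosh r • (1 : Matrix (Fin 2) (Fin 2) ℝ)) := by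
    convert (Real.hasSum_cosh r).smul_const (1 : Matrix (Fin 2) (Fin 2) ℝ) using 2 with k
    rw [hev, smul_smul]
    congr 1
    ring
  have h2 : HasSum (fun k : ℕ => (((2 * k + 1).factorial : ℝ)⁻¹) • A ^ (2 * k + 1))
      ((Real.sinh r / r) • A) := by
    convert ((Real.hasSum_sinh r).div_const r).smul_const A using 2 with k
    rw [pow_succ, hev, smul_mul_assoc, one_mul, smul_smul]
    congr 1
    field_simp
    ring
  exact (HasSum.even_add_odd (f := fun n : ℕ => ((n.factorial : ℝ)⁻¹) • A ^ n) h1 h2).tsum_eq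

theorem Bmat_eq {ϑ : ℝ} (hs : Real.sin ϑ ≠ 0) (hc : Real.cos ϑ ≠ 0) :
    Bmat ϑ = !![-(1 / 2) * Real.cos (2 * ϑ), Real.cos ϑ ^ 3 / Real.sin ϑ;
      Real.sin ϑ ^ 3 / Real.cos ϑ, (1 / 2) * Real.cos (2 * ϑ)] := by
  have h := Real.sin_sq_add_cos_sq ϑ
  have h12 : Real.cos ϑ / Real.sin ϑ - (1 / 2) * Real.sin (2 * ϑ)
      = Real.cos ϑ ^ 3 / Real.sin ϑ := by
    rw [Real.sin_two_mul]
    field_simp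
    linear_combination (-1) * h
  have h21 : Real.sin ϑ / Real.cos ϑ - (1 / 2) * Real.sin (2 * ϑ)
      = Real.sin ϑ ^ 3 / Real.cos ϑ := by
    rw [Real.sin_two_mul]
    field_simp
    linear_combination (-1) * h
  rw [Bmat, h12, h21]

theorem Bmat_sq {ϑ : ℝ} (hs : Real.sin ϑ ≠ 0) (hc : Real.cos ϑ ≠ 0) :
    Bmat ϑ ^ 2 = (1 / 2 : ℝ) ^ 2 • (1 : Matrix (Fin 2) (Fin 2) ℝ) := by
  have h := Real.sin_sq_add_cos_sq (2 * ϑ)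
  rw [Real.sin_two_mul] at h
  have hoff : Real.cos ϑ ^ 3 / Real.sin ϑ * (Real.sin ϑ ^ 3 / Real.cos ϑ)
      = Real.sin ϑ ^ 2 * Real.cos ϑ ^ 2 := by
    field_simp
  rw [Bmat_eq hs hc, sq, Matrix.mul_fin_two, Matrix.one_fin_two]
  ext i j
  fin_cases i <;> fin_cases j <;> simp
  · linear_combination hoff + h / 4
  · ring
  · ring
  · linear_combination hoff + h / 4

theorem thetaF_mem (m qinf ϑ₀ t : ℝ) : thetaF m qinf ϑ₀ t ∈ Ioo (0 : ℝ) (π / 2) := by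
  have h1 := Real.arctan_lt_pi_div_two (Real.cot (2 * ϑ₀) + m * t / (4 * qinf ^ 2))
  have h2 := Real.neg_pi_div_two_lt_arctan (Real.cot (2 * ϑ₀) + m * t / (4 * qinf ^ 2))
  constructor <;> unfold thetaF arccotR <;> linarith

theorem cos_two_mul_thetaF (m qinf ϑ₀ t : ℝ) :
    Real.cos (2 * thetaF m qinf ϑ₀ t)
      = (Real.cot (2 * ϑ₀) + m * t / (4 * qinf ^ 2)) * Real.sin (2 * thetaF m qinf ϑ₀ t) := by
  set x := Real.cot (2 * ϑ₀) + m * t / (4 * qinf ^ 2) with hx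
  have h : 2 * thetaF m qinf ϑ₀ t = π / 2 - Real.arctan x := by
    rw [thetaF, arccotR, ← hx]
    ring
  rw [h, Real.cos_pi_div_two_sub, Real.sin_pi_div_two_sub]
  conv_rhs => rw [← Real.tan_arctan x]
  rw [Real.arctan_tan (Real.neg_pi_div_two_lt_arctan x) (Real.arctan_lt_pi_div_two x),
    Real.tan_mul_cos (Real.cos_arctan_pos x).ne']

/-- Growth of the half-angle tangent `u` and cotangent `v` when the double-angle cotangent
is `k + a * t`. -/
theorem halfAngle_bounds {a k t u v : ℝ} (ha : 0 < a) (ht : 0 ≤ t) (hu : 0 < u)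
    (huv : u * v = 1) (h : 2 * (k + a * t) = v - u) :
    u * (t + 1) ≤ (1 + 2 * |k|) * (1 + |k| / a) + 1 / (2 * a) ∧
      v ≤ (1 + 4 * |k| + 2 * a) * (t + 1) := by
  have hk1 := neg_abs_le k
  have hk2 := le_abs_self k
  have hk0 := abs_nonneg k
  have hat : 0 ≤ a * t := by positivity
  have hu1 : u ≤ 1 + 2 * |k| := by
    by_contra! hlt
    nlinarith
  refine ⟨?_, by nlinarith⟩
  have hat' : u * (a * t) ≤ 1 / 2 + u * |k| := by nlinarith
  have e : u * (t + 1) = u + u * (a * t) / a := by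
    field_simp
    ring
  have h1 : u * (a * t) / a ≤ (1 / 2 + u * |k|) / a := by gcongr
  have h2 : u * (1 + |k| / a) ≤ (1 + 2 * |k|) * (1 + |k| / a) := by gcongr
  have e2 : (1 / 2 + u * |k|) / a = 1 / (2 * a) + u * (|k| / a) := by
    field_simp
  linarith

/-- The off-diagonal entries of `Bmat` along `thetaF`. -/
theorem offDiag_bounds {m qinf : ℝ} (ϑ₀ : ℝ) (hm : 0 < m) (hq : 0 < qinf) :
    ∃ K > 0, ∀ t : ℝ, 0 ≤ t →
      Real.cos (thetaF m qinf ϑ₀ t) ^ 3 / Real.sin (thetaF m qinf ϑ₀ t) ≤ K * (t + 1) ∧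
      Real.sin (thetaF m qinf ϑ₀ t) ^ 3 / Real.cos (thetaF m qinf ϑ₀ t) ≤ K / (t + 1) ^ 3 := by
  set k := Real.cot (2 * ϑ₀) with hk
  set a := m / (4 * qinf ^ 2) with ha_def
  have ha : 0 < a := by positivity
  set L := (1 + 2 * |k|) * (1 + |k| / a) + 1 / (2 * a) with hL
  set R := 1 + 4 * |k| + 2 * a with hR
  have hL0 : 0 < L := by positivity
  have hR0 : 0 < R := by positivity
  refine ⟨R + L ^ 3, by positivity, fun t ht => ?_⟩
  have hmem := thetaF_mem m qinf ϑ₀ t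
  have hcot := cos_two_mul_thetaF m qinf ϑ₀ t
  set ϑ := thetaF m qinf ϑ₀ t
  have hs : 0 < Real.sin ϑ := Real.sin_pos_of_pos_of_lt_pi hmem.1 (by linarith [hmem.2, Real.pi_pos])
  have hc : 0 < Real.cos ϑ := Real.cos_pos_of_mem_Ioo ⟨by linarith [hmem.1, Real.pi_pos], hmem.2⟩
  have hc1 := Real.cos_le_one ϑ
  have hx : k + m * t / (4 * qinf ^ 2) = k + a * t := by
    rw [ha_def]
    ring
  rw [← hk, hx, Real.cos_two_mul', Real.sin_two_mul] at hcot
  obtain ⟨hu, hv⟩ := halfAngle_bounds (k := k) (u := Real.sin ϑ / Real.cos ϑ)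
    (v := Real.cos ϑ / Real.sin ϑ) ha ht (by positivity) (by field_simp)
    (by
      field_simp
      linear_combination -hcot)
  have ht1 : 0 < t + 1 := by linarith
  constructor
  · calc Real.cos ϑ ^ 3 / Real.sin ϑ = Real.cos ϑ ^ 2 * (Real.cos ϑ / Real.sin ϑ) := by ring
      _ ≤ 1 * (Real.cos ϑ / Real.sin ϑ) := by
        gcongr
        exact pow_le_one₀ hc.le hc1
      _ ≤ R * (t + 1) := by rw [one_mul]; exact hv
      _ ≤ (R + L ^ 3) * (t + 1) := by
        gcongr
        linarith [pow_pos hL0 3]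
  · rw [le_div_iff₀ (by positivity)]
    calc Real.sin ϑ ^ 3 / Real.cos ϑ * (t + 1) ^ 3
        = Real.cos ϑ ^ 2 * (Real.sin ϑ / Real.cos ϑ * (t + 1)) ^ 3 := by field_simp
      _ ≤ 1 * L ^ 3 := by
        gcongr
        exact pow_le_one₀ hc.le hc1
      _ ≤ R + L ^ 3 := by linarith

/-- entrywise bounds for `exp(±B(ϑ(t)))` along the explicit angle `ϑ(t)`:
the diagonal entries are `O(1)`, the `(1,2)` entry is `O(t+1)` and the `(2,1)` entry is
`O((t+1)⁻³)`, uniformly for `t ≥ 0`. -/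
theorem statement_10 (m qinf ϑ₀ : ℝ) (hm : 0 < m) (hq : 0 < qinf)
    (hϑ : ϑ₀ ∈ Ioo (0:ℝ) (π / 2)) :
    ∃ C > 0, ∀ t : ℝ, 0 ≤ t →
      |matExp (Bmat (thetaF m qinf ϑ₀ t)) 0 0| ≤ C ∧
      |matExp (Bmat (thetaF m qinf ϑ₀ t)) 1 1| ≤ C ∧
      |matExp (Bmat (thetaF m qinf ϑ₀ t)) 0 1| ≤ C * (t + 1) ∧
      |matExp (Bmat (thetaF m qinf ϑ₀ t)) 1 0| ≤ C / (t + 1) ^ 3 ∧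
      |matExp (-Bmat (thetaF m qinf ϑ₀ t)) 0 0| ≤ C ∧
      |matExp (-Bmat (thetaF m qinf ϑ₀ t)) 1 1| ≤ C ∧
      |matExp (-Bmat (thetaF m qinf ϑ₀ t)) 0 1| ≤ C * (t + 1) ∧
      |matExp (-Bmat (thetaF m qinf ϑ₀ t)) 1 0| ≤ C / (t + 1) ^ 3 := by
  obtain ⟨K, hK, hoff⟩ := offDiag_bounds ϑ₀ hm hq
  set S := Real.sinh (1 / 2) / (1 / 2) with hS_def
  set H := Real.cosh (1 / 2) with hH_def
  have hS : 0 < S := div_pos (Real.sinh_pos_iff.2 (by norm_num)) (by norm_num)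
  have hH : 0 < H := Real.cosh_pos _
  refine ⟨H + S + S * K, by positivity, fun t ht => ?_⟩
  obtain ⟨h12, h21⟩ := hoff t ht
  have hmem := thetaF_mem m qinf ϑ₀ t
  set ϑ := thetaF m qinf ϑ₀ t
  have hs : 0 < Real.sin ϑ := Real.sin_pos_of_pos_of_lt_pi hmem.1 (by linarith [hmem.2, Real.pi_pos])
  have hc : 0 < Real.cos ϑ := Real.cos_pos_of_mem_Ioo ⟨by linarith [hmem.1, Real.pi_pos], hmem.2⟩
  have hsq := Bmat_sq hs.ne' hc.ne'
  have hp := matExp_of_sq (Bmat ϑ) (by norm_num) hsq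
  have hn := matExp_of_sq (-Bmat ϑ) (by norm_num) ((neg_sq _).trans hsq)
  rw [← hS_def, ← hH_def, Bmat_eq hs.ne' hc.ne'] at hp hn
  rw [Bmat_eq hs.ne' hc.ne', hp, hn]
  have ht1 : 0 < t + 1 := by linarith
  have hb12 : S * (Real.cos ϑ ^ 3 / Real.sin ϑ) ≤ (H + S + S * K) * (t + 1) := by
    nlinarith [mul_le_mul_of_nonneg_left h12 hS.le, mul_pos (add_pos hH hS) ht1]
  have hb21 : S * (Real.sin ϑ ^ 3 / Real.cos ϑ) ≤ (H + S + S * K) / (t + 1) ^ 3 := by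
    calc S * (Real.sin ϑ ^ 3 / Real.cos ϑ) ≤ S * (K / (t + 1) ^ 3) := by gcongr
      _ = S * K / (t + 1) ^ 3 := by ring
      _ ≤ (H + S + S * K) / (t + 1) ^ 3 := by
        gcongr
        linarith
  have hp12 : 0 ≤ S * (Real.cos ϑ ^ 3 / Real.sin ϑ) := by positivity
  have hp21 : 0 ≤ S * (Real.sin ϑ ^ 3 / Real.cos ϑ) := by positivity
  have hd1 : S * Real.cos (2 * ϑ) ≤ S := mul_le_of_le_one_right hS.le (Real.cos_le_one _)
  have hd2 : -S ≤ S * Real.cos (2 * ϑ) := by nlinarith [Real.neg_one_le_cos (2 * ϑ)]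
  have hSK : 0 < S * K := by positivity
  refine ⟨?_, ?_, ?_, ?_, ?_, ?_, ?_, ?_⟩ <;>
    simp only [Matrix.add_apply, Matrix.smul_apply, Matrix.neg_apply, Matrix.one_fin_two,
      Matrix.of_apply, Matrix.cons_val', Matrix.cons_val_zero, Matrix.cons_val_one,
      Matrix.cons_val_fin_one, smul_eq_mul] <;>
    rw [abs_le] <;> constructor <;> linarith
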